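/- arXiv:1201.5994 — 2 statements merged into one kernel-verified Lean document; each statement's English description precedes it below -/
import Mathlib

section
/- Let p be a prime, h ≥ 1 an integer, q = p^h, and let S be a finite set of vectors of 𝔽_q^k (k ≥ 1) with the property that every subset of S of size k is a basis of 𝔽_q^k. If k ≤ p, then |S| ≤ q + 1. -/
open Finset in
theorem FiniteField.prod_erase_sub {F : Type*} [Field F] [Fintype F] [DecidableEq F] (x : F) :
    ∏ u ∈ univ.erase x, (x - u) = -1 := by
  have h := congrArg (Units.val) (FiniteField.prod_univ_units_id_eq_neg_one (K := F))
  rw [Units.coe_prod] at h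
  simp only [Units.val_neg, Units.val_one] at h
  rw [← h]
  symm
  refine Finset.prod_nbij (fun w : Fˣ => x - w) ?_ ?_ ?_ ?_
  · intro w _
    simp
  · intro a _ b _ hab
    exact Units.ext (by simpa using hab)
  · intro u hu
    have hu' : x - u ≠ 0 := sub_ne_zero.2 (by simpa [eq_comm] using hu)
    exact ⟨Units.mk0 _ hu', by simp, by simp⟩
  · intro w _
    simp

open Finset Polynomial in
theorem FiniteField.sum_inv_prod_sub_mul_inv_prod_sub {F ι : Type*} [Field F] [Fintype F]
    [DecidableEq F] [DecidableEq ι] {P E : Finset ι} {γ : ι → F} (hEP : E ⊆ P)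
    (hγ : Set.InjOn γ P) (hcard : Fintype.card F + 1 < #P + #E) :
    ∑ a ∈ E, (∏ s ∈ P.erase a, (γ a - γ s))⁻¹ * (∏ z ∈ E.erase a, (γ a - γ z))⁻¹ = 0 := by
  set g : F[X] := ∏ u ∈ univ \ P.image γ, (X - C u) with hg
  have hPim : #(P.image γ) = #P := card_image_of_injOn hγ
  have hPF : #P ≤ Fintype.card F := hPim ▸ card_le_univ _
  have hdeg : g.natDegree = Fintype.card F - #P := by
    rw [hg, natDegree_prod_of_monic _ _ fun u _ => monic_X_sub_C u]
    simp [card_sdiff, hPim]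
  have hgE : g.natDegree < #E - 1 := by omega
  have hlt : g.degree < #E := degree_le_natDegree.trans_lt (by exact_mod_cast (by omega))
  have key := Lagrange.coeff_eq_sum (hγ.mono (coe_subset.2 hEP)) hlt
  rw [coeff_eq_zero_of_natDegree_lt hgE] at key
  have hterm : ∀ a ∈ E, (∏ s ∈ P.erase a, (γ a - γ s))⁻¹ * (∏ z ∈ E.erase a, (γ a - γ z))⁻¹ =
      -(g.eval (γ a) / ∏ z ∈ E.erase a, (γ a - γ z)) := by
    intro a ha
    have haP := hEP ha
    have h1 : (∏ s ∈ P.erase a, (γ a - γ s)) * g.eval (γ a) = -1 := by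
      rw [← FiniteField.prod_erase_sub (γ a), hg, eval_prod]
      simp only [eval_sub, eval_X, eval_C]
      have h2 : ∏ s ∈ P.erase a, (γ a - γ s) = ∏ u ∈ (P.image γ).erase (γ a), (γ a - u) := by
        have : (P.image γ).erase (γ a) = (P.erase a).image γ := by
          ext u
          simp only [mem_erase, mem_image]
          constructor
          · rintro ⟨hu, s, hs, rfl⟩
            exact ⟨s, ⟨fun h => hu (h ▸ rfl), hs⟩, rfl⟩
          · rintro ⟨s, ⟨hsa, hs⟩, rfl⟩
            exact ⟨fun h => hsa (hγ hs haP h), s, hs, rfl⟩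
        rw [this, prod_image (hγ.mono (coe_subset.2 (erase_subset _ _)))]
      rw [h2, ← prod_union]
      · refine prod_congr ?_ fun _ _ => rfl
        ext u
        have hu : u ∉ P.image γ → u ≠ γ a := fun h h' => h (h' ▸ mem_image_of_mem γ haP)
        simp only [mem_union, mem_erase, mem_sdiff, mem_univ, true_and, and_true]
        tauto
      · exact disjoint_sdiff.mono_left (erase_subset _ _)
    have h4 : (∏ s ∈ P.erase a, (γ a - γ s))⁻¹ = -g.eval (γ a) :=
      inv_eq_of_mul_eq_one_right (by linear_combination -h1)
    rw [h4]
    ring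
  rw [sum_congr rfl hterm, sum_neg_distrib, ← key, neg_zero]

open Finset in
/-- The projective version of `FiniteField.sum_inv_prod_sub_mul_inv_prod_sub`: `B` is the
determinant form evaluated at points `(c i, d i)` of the plane. -/
theorem FiniteField.sum_inv_prod_mul_inv_prod {F ι : Type*} [Field F] [Fintype F]
    [DecidableEq F] [DecidableEq ι] {P E : Finset ι} {B : ι → ι → F} {c d : ι → F} (hEP : E ⊆ P)
    (hB : ∀ i ∈ P, ∀ j ∈ P, B i j = c i * d j - c j * d i)
    (hB0 : ∀ i ∈ P, ∀ j ∈ P, i ≠ j → B i j ≠ 0) (hd : ∀ a ∈ E, d a ≠ 0)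
    (hcard : #P + #E = Fintype.card F + 3) :
    ∑ a ∈ E, (∏ s ∈ P.erase a, B a s)⁻¹ * (∏ z ∈ E.erase a, B a z)⁻¹ = 0 := by
  set T := P.filter (d · ≠ 0) with hT
  have hTP : T ⊆ P := filter_subset _ _
  have hET : E ⊆ T := fun a ha => mem_filter.2 ⟨hEP ha, hd a ha⟩
  set γ : ι → F := fun i => c i / d i with hγ
  have hBT : ∀ a ∈ T, ∀ s ∈ T, B a s = d a * d s * (γ a - γ s) := by
    intro a ha s hs
    have h1 := (mem_filter.1 ha).2
    have h2 := (mem_filter.1 hs).2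
    rw [hB a (hTP ha) s (hTP hs), hγ]
    field_simp
  have hγT : Set.InjOn γ T := by
    intro a ha s hs has
    by_contra hne
    apply hB0 a (hTP ha) s (hTP hs) hne
    rw [hBT a ha s hs, has, sub_self, mul_zero]
  have hcT : #(P \ T) ≤ 1 := by
    rw [card_le_one]
    intro i hi j hj
    by_contra hne
    have hi' : d i = 0 := by
      by_contra h
      exact (mem_sdiff.1 hi).2 (mem_filter.2 ⟨(mem_sdiff.1 hi).1, h⟩)
    have hj' : d j = 0 := by
      by_contra h
      exact (mem_sdiff.1 hj).2 (mem_filter.2 ⟨(mem_sdiff.1 hj).1, h⟩)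
    apply hB0 i (mem_sdiff.1 hi).1 j (mem_sdiff.1 hj).1 hne
    rw [hB i (mem_sdiff.1 hi).1 j (mem_sdiff.1 hj).1, hi', hj']
    ring
  have hcs : #(P \ T) + #T = #P := card_sdiff_add_card_eq_card hTP
  have key := FiniteField.sum_inv_prod_sub_mul_inv_prod_sub hET hγT (by omega)
  set K : F := (∏ s ∈ T, d s) * (∏ s ∈ P \ T, -c s) * ∏ s ∈ E, d s with hK
  have hterm : ∀ a ∈ E, (∏ s ∈ P.erase a, B a s)⁻¹ * (∏ z ∈ E.erase a, B a z)⁻¹ =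
      K⁻¹ * ((∏ s ∈ T.erase a, (γ a - γ s))⁻¹ * (∏ z ∈ E.erase a, (γ a - γ z))⁻¹) := by
    intro a ha
    have hda := hd a ha
    have haT := hET ha
    have h1 : ∏ z ∈ E.erase a, B a z =
        d a ^ (#E - 1) * (∏ s ∈ E.erase a, d s) * ∏ z ∈ E.erase a, (γ a - γ z) := by
      rw [← card_erase_of_mem ha, ← prod_const, ← prod_mul_distrib, ← prod_mul_distrib]
      exact prod_congr rfl fun z hz => hBT a haT z (hET (mem_of_mem_erase hz))
    have h2 : ∏ z ∈ T.erase a, B a z =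
        d a ^ (#T - 1) * (∏ s ∈ T.erase a, d s) * ∏ z ∈ T.erase a, (γ a - γ z) := by
      rw [← card_erase_of_mem haT, ← prod_const, ← prod_mul_distrib, ← prod_mul_distrib]
      exact prod_congr rfl fun z hz => hBT a haT z (mem_of_mem_erase hz)
    have h3 : ∏ z ∈ P \ T, B a z = d a ^ #(P \ T) * ∏ s ∈ P \ T, -c s := by
      rw [← prod_const, ← prod_mul_distrib]
      refine prod_congr rfl fun z hz => ?_
      have hz' : d z = 0 := by
        by_contra h
        exact (mem_sdiff.1 hz).2 (mem_filter.2 ⟨(mem_sdiff.1 hz).1, h⟩)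
      rw [hB a (hTP haT) z (mem_sdiff.1 hz).1, hz']
      ring
    have h4 : ∏ s ∈ P.erase a, B a s = (∏ z ∈ P \ T, B a z) * ∏ z ∈ T.erase a, B a z := by
      rw [← prod_union]
      · congr 1
        ext s
        have := @hTP s
        simp only [mem_erase, mem_union, mem_sdiff]
        by_cases hs : s = a
        · simp [hs, haT]
        · tauto
      · exact sdiff_disjoint.mono_right (erase_subset _ _)
    have hT1 := mul_prod_erase T d haT
    have hE1 := mul_prod_erase E d ha
    have hpos : 0 < #E := card_pos.2 ⟨a, ha⟩
    have hposT : 0 < #T := card_pos.2 ⟨a, haT⟩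
    have hpow : d a ^ #(P \ T) * d a ^ (#T - 1) * d a ^ (#E - 1) = d a * d a := by
      rw [← pow_add, ← pow_add, show #(P \ T) + (#T - 1) + (#E - 1) = Fintype.card F + 1 by omega,
        pow_succ, FiniteField.pow_card]
    rw [← mul_inv, ← mul_inv, ← mul_inv, h4, h3, h2, h1, hK, ← hT1, ← hE1]
    congr 1
    linear_combination (∏ s ∈ P \ T, -c s) * (∏ s ∈ T.erase a, d s) *
      (∏ z ∈ T.erase a, (γ a - γ z)) * (∏ s ∈ E.erase a, d s) *
      (∏ z ∈ E.erase a, (γ a - γ z)) * hpow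
  rw [sum_congr rfl hterm, ← mul_sum, key, mul_zero]

open Finset in
/-- The inclusion matrix of `m`-subsets versus `(m + 1)`-subsets of a `(2 * m + 1)`-set is
nonsingular over a field in which `1, …, m + 1` are nonzero. -/
theorem Finset.eq_zero_of_forall_sum_insert_eq_zero {F ι : Type*} [Field F] [DecidableEq ι] {m : ℕ}
    (hF : ∀ j < m + 1, ((j + 1 : ℕ) : F) ≠ 0) {E : Finset ι} (hE : #E = 2 * m + 1)
    {β : Finset ι → F}
    (hβ : ∀ A ⊆ E, #A = m → ∑ a ∈ E \ A, β (insert a A) = 0)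
    {C : Finset ι} (hCE : C ⊆ E) (hC : #C = m + 1) : β C = 0 := by
  set N : ℕ → F := fun j => ∑ D ∈ (powersetCard (m + 1) E).filter (fun D => #(D ∩ C) = j), β D
    with hN
  have hrec : ∀ j ≤ m, ((m + 1 - j : ℕ) : F) * N j + ((j + 1 : ℕ) : F) * N (j + 1) = 0 := by
    intro j hj
    have h0 : ∑ A ∈ (powersetCard m E).filter (fun A => #(A ∩ C) = j),
        ∑ a ∈ E \ A, β (insert a A) = 0 := by
      refine sum_eq_zero fun A hA => ?_
      rw [mem_filter, mem_powersetCard] at hA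
      exact hβ A hA.1.1 hA.1.2
    have h1 : ∑ A ∈ (powersetCard m E).filter (fun A => #(A ∩ C) = j),
        ∑ a ∈ E \ A, β (insert a A) =
        ∑ D ∈ powersetCard (m + 1) E, ∑ a ∈ D.filter (fun a => #(D.erase a ∩ C) = j), β D := by
      rw [sum_sigma', sum_sigma']
      refine sum_bij' (fun x _ => ⟨insert x.2 x.1, x.2⟩) (fun x _ => ⟨x.1.erase x.2, x.2⟩)
        ?_ ?_ ?_ ?_ ?_
      · rintro ⟨A, a⟩ h
        simp only [mem_sigma, mem_filter, mem_powersetCard, mem_sdiff] at h ⊢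
        obtain ⟨⟨⟨hAE, hA⟩, hj⟩, haE, haA⟩ := h
        refine ⟨⟨insert_subset haE hAE, by rw [card_insert_of_notMem haA, hA]⟩,
          mem_insert_self _ _, ?_⟩
        rw [erase_insert haA, hj]
      · rintro ⟨D, a⟩ h
        simp only [mem_sigma, mem_filter, mem_powersetCard, mem_sdiff] at h ⊢
        obtain ⟨⟨hDE, hD⟩, haD, hj⟩ := h
        refine ⟨⟨⟨(erase_subset _ _).trans hDE, by rw [card_erase_of_mem haD, hD]; rfl⟩, hj⟩,
          hDE haD, notMem_erase _ _⟩
      · rintro ⟨A, a⟩ h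
        simp only [mem_sigma, mem_filter, mem_powersetCard, mem_sdiff] at h
        simp [erase_insert h.2.2]
      · rintro ⟨D, a⟩ h
        simp only [mem_sigma, mem_filter, mem_powersetCard] at h
        simp [insert_erase h.2.1]
      · rintro ⟨A, a⟩ h
        rfl
    have h2 : ∀ D ∈ powersetCard (m + 1) E,
        ∑ a ∈ D.filter (fun a => #(D.erase a ∩ C) = j), β D =
        ((m + 1 - j : ℕ) : F) * (if #(D ∩ C) = j then β D else 0) +
          ((j + 1 : ℕ) : F) * (if #(D ∩ C) = j + 1 then β D else 0) := by
      intro D hD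
      rw [mem_powersetCard] at hD
      rw [sum_const, nsmul_eq_mul]
      have hin : ∀ a ∈ D, a ∈ C → #(D.erase a ∩ C) = #(D ∩ C) - 1 := by
        intro a ha haC
        rw [erase_inter, card_erase_of_mem (mem_inter.2 ⟨ha, haC⟩)]
      have hout : ∀ a ∈ D, a ∉ C → #(D.erase a ∩ C) = #(D ∩ C) := by
        intro a ha haC
        rw [erase_inter, erase_eq_of_notMem fun h => haC (mem_inter.1 h).2]
      have hcs := card_sdiff_add_card_inter D C
      by_cases hj0 : #(D ∩ C) = j
      · have : D.filter (fun a => #(D.erase a ∩ C) = j) = D \ C := by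
          ext a
          simp only [mem_filter, mem_sdiff]
          refine and_congr_right fun ha => ?_
          by_cases haC : a ∈ C
          · have : 0 < #(D ∩ C) := card_pos.2 ⟨a, mem_inter.2 ⟨ha, haC⟩⟩
            simp only [haC, hin a ha haC, not_true_eq_false, iff_false]
            omega
          · simp only [haC, hout a ha haC, hj0, not_false_eq_true]
        rw [this, if_pos hj0, if_neg (by omega), show #(D \ C) = m + 1 - j by omega]
        ring
      · by_cases hj1 : #(D ∩ C) = j + 1
        · have : D.filter (fun a => #(D.erase a ∩ C) = j) = D ∩ C := by
            ext a
            simp only [mem_filter, mem_inter]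
            refine and_congr_right fun ha => ?_
            by_cases haC : a ∈ C
            · simp only [haC, hin a ha haC, hj1, add_tsub_cancel_right]
            · simp only [haC, hout a ha haC, hj0]
          rw [this, if_neg hj0, if_pos hj1, hj1]
          ring
        · have : D.filter (fun a => #(D.erase a ∩ C) = j) = ∅ := by
            refine filter_eq_empty_iff.2 fun a ha => ?_
            by_cases haC : a ∈ C
            · rw [hin a ha haC]
              omega
            · rw [hout a ha haC]
              omega
          rw [this, if_neg hj0, if_neg hj1]
          simp
    rw [h1, sum_congr rfl h2, sum_add_distrib, ← mul_sum, ← mul_sum, ← sum_filter,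
      ← sum_filter] at h0
    exact h0
  have hzero : ∀ j ≤ m + 1, N j = 0 := by
    intro j
    induction j with
    | zero =>
      intro _
      refine sum_eq_zero fun D hD => ?_
      rw [mem_filter, mem_powersetCard, card_eq_zero, ← disjoint_iff_inter_eq_empty] at hD
      have h1 := card_le_card (union_subset hD.1.1 hCE)
      rw [card_union_of_disjoint hD.2] at h1
      omega
    | succ j ih =>
      intro hj
      have h1 := hrec j (by omega)
      rw [ih (by omega), mul_zero, zero_add] at h1
      exact (mul_eq_zero.1 h1).resolve_left (hF j (by omega))
  have hlast := hzero (m + 1) le_rfl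
  have : (powersetCard (m + 1) E).filter (fun D => #(D ∩ C) = m + 1) = {C} := by
    ext D
    simp only [mem_filter, mem_powersetCard, mem_singleton]
    constructor
    · rintro ⟨⟨_, hD⟩, h⟩
      have h1 : D ∩ C = D := eq_of_subset_of_card_le inter_subset_left (by omega)
      have h2 : D ∩ C = C := eq_of_subset_of_card_le inter_subset_right (by omega)
      exact h1.symm.trans h2
    · rintro rfl
      simp [hCE, hC]
  simpa [hN, this] using hlast

/-- The alternating bilinear form `(x, y) ↦ det (x, y, w)`. -/
noncomputable def Matrix.detCons {F : Type*} [Field F] {m : ℕ} (w : Fin m → Fin (m + 2) → F) :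
    (Fin (m + 2) → F) →ₗ[F] (Fin (m + 2) → F) →ₗ[F] F :=
  LinearMap.mk₂ F
    (fun x y => (Matrix.detRowAlternating (n := Fin (m + 2)) (R := F)).curryLeft x
      (Matrix.vecCons y w))
    (by intros; simp [-AlternatingMap.curryLeft_apply_apply])
    (by intros; simp [-AlternatingMap.curryLeft_apply_apply])
    (by intros; exact AlternatingMap.map_vecCons_add _ _ _ _)
    (by intros; exact AlternatingMap.map_vecCons_smul _ _ _ _)

theorem Matrix.detCons_apply {F : Type*} [Field F] {m : ℕ} (w : Fin m → Fin (m + 2) → F)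
    (x y : Fin (m + 2) → F) :
    Matrix.detCons w x y = Matrix.det (Matrix.vecCons x (Matrix.vecCons y w)) := rfl

theorem Matrix.detCons_self {F : Type*} [Field F] {m : ℕ} (w : Fin m → Fin (m + 2) → F)
    (z : Fin (m + 2) → F) : Matrix.detCons w z z = 0 :=
  Matrix.det_zero_of_row_eq (i := 0) (j := 1) (by simp) rfl

theorem Matrix.detCons_neg {F : Type*} [Field F] {m : ℕ} (w : Fin m → Fin (m + 2) → F)
    (x y : Fin (m + 2) → F) : -Matrix.detCons w y x = Matrix.detCons w x y := by
  have := Matrix.detCons_self w (x + y)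
  simp only [map_add, LinearMap.add_apply, Matrix.detCons_self] at this
  linear_combination -this

theorem Matrix.detCons_mul_detCons {F : Type*} [Field F] {m : ℕ} (w : Fin m → Fin (m + 2) → F)
    (x y : Fin (m + 2) → F) {e f : Fin (m + 2) → F} (hef : Matrix.detCons w e f ≠ 0) :
    Matrix.detCons w x y * Matrix.detCons w e f =
      Matrix.detCons w x f * Matrix.detCons w e y - Matrix.detCons w x e * Matrix.detCons w f y := by
  set M : Matrix (Fin (m + 2)) (Fin (m + 2)) F := Matrix.vecCons e (Matrix.vecCons f w) with hM
  have hMu : IsUnit M.det := isUnit_iff_ne_zero.2 hef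
  set c := Matrix.vecMul x M⁻¹ with hc
  have hx : x = ∑ i, c i • M i := by
    rw [← Matrix.vecMul_eq_sum, hc, Matrix.vecMul_vecMul, Matrix.nonsing_inv_mul M hMu,
      Matrix.vecMul_one]
  have hw : ∀ i z, Matrix.detCons w (w i) z = 0 := fun i z =>
    Matrix.det_zero_of_row_eq (i := 0) (j := i.succ.succ) (Fin.succ_ne_zero _).symm rfl
  have hxz : ∀ z, Matrix.detCons w x z =
      c 0 * Matrix.detCons w e z + c 1 * Matrix.detCons w f z := by
    intro z
    rw [hx]
    simp [Fin.sum_univ_succ, hM, hw]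
  rw [hxz, hxz, hxz, Matrix.detCons_self, Matrix.detCons_self, ← Matrix.detCons_neg w f e]
  ring

open Finset in
theorem Matrix.sum_inv_prod_detCons_eq_zero {F ι : Type*} [Field F] [Fintype F] [DecidableEq F]
    [DecidableEq ι] {m : ℕ} (w : Fin m → Fin (m + 2) → F) (v : ι → Fin (m + 2) → F)
    {P E : Finset ι} (hEP : E ⊆ P) (hE : #E < Fintype.card F)
    (hv : ∀ i ∈ P, ∀ j ∈ P, i ≠ j → Matrix.detCons w (v i) (v j) ≠ 0)
    (hcard : #P + #E = Fintype.card F + 3) :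
    ∑ a ∈ E, (∏ s ∈ P.erase a, Matrix.detCons w (v a) (v s))⁻¹ *
      (∏ z ∈ E.erase a, Matrix.detCons w (v a) (v z))⁻¹ = 0 := by
  rcases E.eq_empty_or_nonempty with rfl | ⟨a₀, ha₀⟩
  · simp
  obtain ⟨b, hbP, hb⟩ : ∃ b ∈ P, b ≠ a₀ := exists_mem_ne (by omega) a₀
  obtain ⟨e, he⟩ : ∃ e, ∀ a ∈ E, Matrix.detCons w e (v a) ≠ 0 := by
    set bad := E.image fun a =>
      -Matrix.detCons w (v b) (v a) / Matrix.detCons w (v a₀) (v a) with hbad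
    obtain ⟨l, hl⟩ : ∃ l, l ∉ bad := by
      by_contra! h
      have h1 : #(univ : Finset F) ≤ #bad := card_le_card fun l _ => h l
      have h2 : #bad ≤ #E := card_image_le
      rw [card_univ] at h1
      omega
    refine ⟨v b + l • v a₀, fun a ha h => ?_⟩
    simp only [map_add, map_smul, LinearMap.add_apply, LinearMap.smul_apply, smul_eq_mul] at h
    by_cases haa : a = a₀
    · rw [haa, Matrix.detCons_self, mul_zero, add_zero] at h
      exact hv b hbP a₀ (hEP ha₀) hb h
    · apply hl
      rw [hbad, mem_image]
      refine ⟨a, ha, ?_⟩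
      rw [div_eq_iff (hv a₀ (hEP ha₀) a (hEP ha) (Ne.symm haa))]
      linear_combination -h
  refine FiniteField.sum_inv_prod_mul_inv_prod (B := fun i j => Matrix.detCons w (v i) (v j))
    (c := fun i => -(Matrix.detCons w (v a₀) (v i) / Matrix.detCons w e (v a₀)))
    (d := fun i => Matrix.detCons w e (v i)) hEP ?_ hv he hcard
  intro i _ j _
  have h0 := he a₀ ha₀
  have h := Matrix.detCons_mul_detCons w (v i) (v j) h0
  rw [← Matrix.detCons_neg w (v i) (v a₀), ← Matrix.detCons_neg w (v i) e] at h
  field_simp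
  linear_combination h

theorem Function.Injective.exists_perm_comp_eq {α β : Type*} {f g : α → β}
    (hf : Function.Injective f) (hg : Function.Injective g) (h : Set.range f = Set.range g) :
    ∃ π : Equiv.Perm α, f = g ∘ π := by
  refine ⟨(Equiv.ofInjective f hf).trans
    ((Equiv.setCongr h).trans (Equiv.ofInjective g hg).symm), ?_⟩
  funext x
  simp [Equiv.apply_ofInjective_symm]

open Finset in
/-- For `m + 2` at most the characteristic, no `q + 2` vectors of `𝔽_q ^ (m + 2)` have the property
that a linear functional vanishing on `m + 2` of them is zero, provided `2 * m + 1 ≤ q + 2`. -/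
theorem not_forall_dotProduct_eq_zero_imp {F ι : Type*} [Field F] [Fintype F] [DecidableEq F]
    [Fintype ι] [DecidableEq ι] {m : ℕ} (hF : ∀ j < m + 1, ((j + 1 : ℕ) : F) ≠ 0)
    (hmF : m + 1 < Fintype.card F) (hι : Fintype.card ι = Fintype.card F + 2)
    (hm : 2 * m + 1 ≤ Fintype.card F + 2) (v : ι → Fin (m + 2) → F) :
    ¬ ∀ I : Finset ι, #I = m + 2 → ∀ c, (∀ i ∈ I, v i ⬝ᵥ c = 0) → c = 0 := by
  intro harc
  have hdet : ∀ f : Fin (m + 2) → ι, Function.Injective f → Matrix.det (fun i => v (f i)) ≠ 0 := by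
    intro f hf h0
    obtain ⟨c, hc, hc0⟩ := Matrix.exists_mulVec_eq_zero_iff.2 h0
    refine hc (harc (univ.image f) (by simp [card_image_of_injective _ hf]) c ?_)
    intro i hi
    obtain ⟨j, -, rfl⟩ := mem_image.1 hi
    exact congrFun hc0 j
  have : Nonempty ι := Fintype.card_pos_iff.1 (by omega)
  have henum : ∀ (n : ℕ) (C : Finset ι), ∃ e : Fin n → ι,
      #C = n → Function.Injective e ∧ ∀ i, i ∈ Set.range e ↔ i ∈ C := by
    intro n C
    by_cases hC : #C = n
    · refine ⟨fun i => (C.equivFinOfCardEq hC).symm i, fun _ => ⟨?_, ?_⟩⟩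
      · exact Subtype.val_injective.comp (Equiv.injective _)
      · intro i
        constructor
        · rintro ⟨j, rfl⟩
          exact Subtype.property _
        · intro hi
          exact ⟨C.equivFinOfCardEq hC ⟨i, hi⟩, by simp⟩
    · exact ⟨fun _ => Classical.arbitrary ι, fun h => absurd h hC⟩
  choose en hen using henum
  set δ : Finset ι → ι → F := fun C s =>
    Matrix.det (Matrix.vecCons (v s) (fun i => v (en (m + 1) C i))) with hδ
  obtain ⟨E, -, hE⟩ := exists_subset_card_eq (s := (univ : Finset ι)) (n := 2 * m + 1)
    (by rw [card_univ]; omega)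
  set β : Finset ι → F := fun C =>
    (∏ s ∈ univ \ C, δ C s)⁻¹ * (∏ z ∈ E \ C, δ C z)⁻¹ with hβ
  obtain ⟨C, hCE, hC⟩ := exists_subset_card_eq (s := E) (n := m + 1) (by omega)
  have hδ0 : ∀ s ∉ C, δ C s ≠ 0 := by
    intro s hs
    have := hdet (Matrix.vecCons s (en (m + 1) C)) ?_
    · convert this
      refine congrArg Matrix.det ?_
      funext i
      exact Fin.cases rfl (fun _ => rfl) i
    · rw [Matrix.vecCons, Fin.cons_injective_iff]
      exact ⟨fun h => hs (((hen _ C hC).2 s).1 h), (hen _ C hC).1⟩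
  have hβ0 : β C ≠ 0 := by
    refine mul_ne_zero (inv_ne_zero (prod_ne_zero_iff.2 ?_)) (inv_ne_zero (prod_ne_zero_iff.2 ?_))
    · exact fun s hs => hδ0 s (mem_sdiff.1 hs).2
    · exact fun s hs => hδ0 s (mem_sdiff.1 hs).2
  refine hβ0 (Finset.eq_zero_of_forall_sum_insert_eq_zero hF hE (fun A hAE hA => ?_) hCE hC)
  obtain ⟨hAi, hAr⟩ := hen m A hA
  set w : Fin m → Fin (m + 2) → F := fun i => v (en m A i) with hw
  have hcU : #(univ \ A) = Fintype.card F + 2 - m := by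
    rw [card_sdiff_of_subset (subset_univ _), card_univ, hι, hA]
  have hcE : #(E \ A) = m + 1 := by
    rw [card_sdiff_of_subset hAE, hE, hA]
    omega
  have key := Matrix.sum_inv_prod_detCons_eq_zero w v (P := univ \ A) (E := E \ A)
    (sdiff_subset_sdiff (subset_univ _) le_rfl) (by omega) ?_ (by omega)
  · rw [← key]
    refine sum_congr rfl fun a ha => ?_
    have haA := (mem_sdiff.1 ha).2
    have hins : #(insert a A) = m + 1 := by rw [card_insert_of_notMem haA, hA]
    obtain ⟨hCi, hCr⟩ := hen (m + 1) _ hins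
    have hcons : Function.Injective (Matrix.vecCons a (en m A)) := by
      rw [Matrix.vecCons, Fin.cons_injective_iff]
      exact ⟨fun h => haA ((hAr a).1 h), hAi⟩
    obtain ⟨π, hπ⟩ := hcons.exists_perm_comp_eq hCi (by
      ext i
      rw [hCr, Matrix.range_cons, mem_insert]
      exact or_congr Iff.rfl (hAr i))
    obtain ⟨σ, hσ, hσB⟩ : ∃ σ : F, σ * σ = 1 ∧ ∀ s,
        Matrix.detCons w (v a) (v s) = σ * δ (insert a A) s := by
      refine ⟨-((Equiv.Perm.sign π : ℤ) : F), ?_, fun s => ?_⟩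
      · rw [neg_mul_neg, ← Int.cast_mul, ← Units.val_mul, Int.units_mul_self]
        simp
      · rw [← Matrix.detCons_neg, Matrix.detCons_apply]
        have h1 : Matrix.vecCons (v a) w = (fun i => v (en (m + 1) (insert a A) i)) ∘ π := by
          funext i
          rw [Function.comp_apply, ← Function.comp_apply (f := en _ _), ← hπ]
          exact Fin.cases rfl (fun _ => rfl) i
        have h2 := ((Matrix.detRowAlternating (n := Fin (m + 2)) (R := F)).curryLeft (v s)).map_perm
          (fun i => v (en (m + 1) (insert a A) i)) π
        rw [← h1] at h2
        have h3 : Matrix.det (Matrix.vecCons (v s) (Matrix.vecCons (v a) w)) =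
          Equiv.Perm.sign π • δ (insert a A) s := h2
        rw [h3, Units.smul_def, zsmul_eq_mul, neg_mul]
    have hU : univ \ insert a A = (univ \ A).erase a := by
      rw [sdiff_insert]
    have hEa : E \ insert a A = (E \ A).erase a := by
      rw [sdiff_insert]
    have haU : a ∈ univ \ A := by simpa using haA
    simp only [hσB, prod_mul_distrib, prod_const, hβ, hU, hEa, card_erase_of_mem ha,
      card_erase_of_mem haU, hcU, hcE]
    have hpow : σ ^ (Fintype.card F + 2 - m - 1) * σ ^ (m + 1 - 1) = 1 := by
      rw [← pow_add, show Fintype.card F + 2 - m - 1 + (m + 1 - 1) = Fintype.card F + 1 by omega,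
        pow_succ, FiniteField.pow_card, hσ]
    rw [← mul_inv, ← mul_inv]
    congr 1
    linear_combination -(∏ s ∈ (univ \ A).erase a, δ (insert a A) s) *
      (∏ s ∈ (E \ A).erase a, δ (insert a A) s) * hpow
  · intro i hi j hj hij
    have hiA := (mem_sdiff.1 hi).2
    have hjA := (mem_sdiff.1 hj).2
    have := hdet (Matrix.vecCons i (Matrix.vecCons j (en m A))) ?_
    · rw [Matrix.detCons_apply]
      convert this
      refine congrArg Matrix.det ?_
      funext l
      exact Fin.cases rfl (fun l => Fin.cases rfl (fun _ => rfl) l) l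
    · rw [Matrix.vecCons, Fin.cons_injective_iff, Matrix.vecCons, Fin.cons_injective_iff]
      refine ⟨?_, fun h => hjA ((hAr j).1 h), hAi⟩
      rintro ⟨l, hl⟩
      revert hl
      refine Fin.cases (fun hl => hij hl.symm) (fun l hl => ?_) l
      exact hiA ((hAr i).1 ⟨l, hl⟩)

open Finset in
/-- The dual of an arc: the coordinate functionals on the space of linear relations. -/
theorem exists_dual_arc {F ι : Type*} [Field F] [Fintype ι] [DecidableEq ι] {k l : ℕ}
    (v : ι → Fin k → F) (hkl : Fintype.card ι = k + l)
    (hv : ∀ I : Finset ι, #I = k → LinearIndepOn F v I) :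
    ∃ v' : ι → Fin l → F, ∀ I : Finset ι, #I = l → ∀ c, (∀ i ∈ I, v' i ⬝ᵥ c = 0) → c = 0 := by
  have hfr : l ≤ Module.finrank F (LinearMap.ker (Fintype.linearCombination F v)) := by
    have h1 := LinearMap.finrank_range_add_finrank_ker (Fintype.linearCombination F v)
    have h2 := Submodule.finrank_le (LinearMap.range (Fintype.linearCombination F v))
    rw [Module.finrank_fintype_fun_eq_card, hkl] at h1
    rw [Module.finrank_fintype_fun_eq_card, Fintype.card_fin] at h2
    omega
  obtain ⟨b, hb⟩ := exists_linearIndependent_of_le_finrank hfr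
  refine ⟨fun i j => (b j : ι → F) i, fun I hI c hc => ?_⟩
  set x := ∑ j, c j • b j with hx
  have hxI : ∀ i ∈ I, (x : ι → F) i = 0 := by
    intro i hi
    rw [← hc i hi, hx]
    simp [dotProduct, mul_comm]
  have hx0 : x = 0 := by
    have hker : ∑ i, (x : ι → F) i • v i = 0 := by
      have := x.2
      rwa [LinearMap.mem_ker, Fintype.linearCombination_apply] at this
    have hsum : ∑ i ∈ Iᶜ, (x : ι → F) i • v i = 0 := by
      rw [← hker]
      refine sum_subset (subset_univ _) fun i _ hi => ?_
      rw [hxI i (by simpa using hi), zero_smul]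
    have hli := hv Iᶜ (by rw [card_compl]; omega)
    rw [linearIndepOn_finset_iff] at hli
    ext i
    by_cases hi : i ∈ I
    · exact hxI i hi
    · exact hli _ hsum i (mem_compl.2 hi)
  funext j
  exact Fintype.linearIndependent_iff.1 hb c hx0 j

/-- Let `p` be a prime, `h ≥ 1`, `q = p^h`, and let `S` be a finite set of
vectors of `𝔽_q^k` (`k ≥ 1`) such that every subset of `S` of size `k` is a basis of
`𝔽_q^k`.  If `k ≤ p` then `|S| ≤ q + 1`. -/
theorem statement0 (p h k : ℕ) (hp : p.Prime) (hh : 1 ≤ h) (hk : 1 ≤ k)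
    (F : Type) [Field F] [Fintype F] [DecidableEq F] (hF : Fintype.card F = p ^ h)
    (S : Finset (Fin k → F))
    (harc : ∀ A ⊆ S, A.card = k →
      LinearIndependent F (fun v : {x // x ∈ A} => (v : Fin k → F)) ∧
      Submodule.span F (A : Set (Fin k → F)) = ⊤)
    (hkp : k ≤ p) :
    S.card ≤ p ^ h + 1 := by
  by_contra! hS
  obtain ⟨T, hTS, hT⟩ := Finset.exists_subset_card_eq (s := S) (n := p ^ h + 2) (by omega)
  have hpq : p ≤ p ^ h := Nat.le_self_pow (by omega) p
  have hchar : CharP F p := by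
    have : Fact p.Prime := ⟨hp⟩
    exact charP_of_card_eq_prime_pow hF
  have hcast : ∀ m, m + 2 ≤ p → ∀ j < m + 1, ((j + 1 : ℕ) : F) ≠ 0 := by
    intro m hm j hj h0
    have := Nat.le_of_dvd (by omega) ((CharP.cast_eq_zero_iff F p (j + 1)).1 h0)
    omega
  have hTcard : Fintype.card T = Fintype.card F + 2 := by simp [hT, hF]
  obtain rfl | ⟨m, rfl⟩ : k = 1 ∨ ∃ m, k = m + 2 := by
    rcases k with _ | _ | m
    · omega
    · exact Or.inl rfl
    · exact Or.inr ⟨m, rfl⟩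
  · have h1 := T.card_le_univ
    simp only [Fintype.card_pi, Finset.univ_unique, Finset.prod_singleton] at h1
    omega
  have himage : ∀ I : Finset T, I.map (Function.Embedding.subtype _) ⊆ S := by
    intro I x hx
    obtain ⟨y, -, rfl⟩ := Finset.mem_map.1 hx
    exact hTS y.2
  by_cases hm : 2 * m + 1 ≤ Fintype.card F + 2
  · refine not_forall_dotProduct_eq_zero_imp (hcast m hkp) (by omega) hTcard hm
      (fun t : T => (t : Fin (m + 2) → F)) fun I hI c hc => ?_
    have hspan := (harc _ (himage I) (by rw [Finset.card_map, hI])).2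
    have hle : (⊤ : Submodule F (Fin (m + 2) → F)) ≤
        LinearMap.ker (LinearMap.flip (dotProductBilin F F) c) := by
      rw [← hspan, Submodule.span_le]
      intro x hx
      obtain ⟨y, hy, rfl⟩ := Finset.mem_map.1 hx
      exact hc y hy
    funext i
    simpa using hle (x := Pi.single i 1) trivial
  · obtain ⟨l, hl⟩ : ∃ l, p = m + 2 + l := ⟨p - (m + 2), by omega⟩
    have hh1 : h = 1 := by
      by_contra hne
      have h2 : p ^ 2 ≤ p ^ h := Nat.pow_le_pow_right hp.pos (by omega)
      have h3 := hp.two_le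
      nlinarith
    subst hh1
    rw [pow_one] at *
    obtain ⟨v', hv'⟩ := exists_dual_arc (l := l + 2) (fun t : T => (t : Fin (m + 2) → F))
      (by omega) (fun I hI => by
        have hli := (harc _ (himage I) (by rw [Finset.card_map, hI])).1
        refine (LinearIndependent.comp hli
          (fun t : I => ⟨t.1.1, Finset.mem_map.2 ⟨t.1, t.2, rfl⟩⟩) ?_ :)
        intro s t hst
        exact Subtype.ext (Subtype.ext (Subtype.mk.inj hst)))
    exact not_forall_dotProduct_eq_zero_imp (hcast l (by omega)) (by omega) hTcard (by omega) v' hv'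
end

section
/- Let p be a prime, h ≥ 2 an integer (so q = p^h is not prime), and let S be a finite set of vectors of 𝔽_q^k (k ≥ 1) with the property that every subset of S of size k is a basis of 𝔽_q^k. If k ≤ 2p − 2, then |S| ≤ q + 1. -/
section

open Finset

theorem prod_sub_const_erase {F : Type*} [Field F] [Fintype F] [DecidableEq F] (a : F) :
    ∏ r ∈ univ.erase a, (r - a) = -1 := by
  have h := FiniteField.prod_univ_units_id_eq_neg_one (K := F)
  have h2 : ∏ u : Fˣ, (u : F) = -1 := by
    have := congrArg (Units.val) h
    simpa using this
  rw [← h2]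
  symm
  refine Finset.prod_bij (fun u _ => (u : F) + a) ?_ ?_ ?_ ?_
  · intro u _
    simp
  · intro u _ v _ h
    exact Units.ext (add_right_cancel h)
  · intro r hr
    exact ⟨Units.mk0 (r - a) (sub_ne_zero.2 (ne_of_mem_erase hr)), mem_univ _, by simp⟩
  · intro u _
    simp

theorem sum_inv_prod_sub_mul_prod_sub {F α : Type*} [Field F] [Fintype F] [DecidableEq F]
    [DecidableEq α] (σ : α → F) (S E : Finset α) (hES : E ⊆ S) (hσ : Set.InjOn σ S)
    (hcard : S.card + E.card = Fintype.card F + 1) :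
    ∑ a ∈ E, ((∏ s ∈ S.erase a, (σ s - σ a)) * ∏ z ∈ E.erase a, (σ z - σ a))⁻¹ = -1 := by
  set R : Finset F := univ \ S.image σ with hR
  have hRcard : R.card + 1 = E.card := by
    have h1 := card_sdiff_add_card_eq_card (subset_univ (S.image σ))
    rw [card_image_of_injOn hσ, card_univ, ← hR] at h1
    omega
  set g : Polynomial F := ∏ r ∈ R, (Polynomial.X - Polynomial.C r) with hg
  have hmonic : g.Monic := Polynomial.monic_prod_of_monic _ _ fun r _ => Polynomial.monic_X_sub_C r
  have hdeg : g.degree = R.card := by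
    rw [hg, Polynomial.degree_prod]; simp
  have hE : Set.InjOn σ E := hσ.mono hES
  have hL := Lagrange.leadingCoeff_eq_sum hE (P := g) (by rw [hdeg, ← hRcard]; rfl)
  rw [hmonic.leadingCoeff] at hL
  rw [hL, ← sum_neg_distrib]
  refine sum_congr rfl fun a ha => ?_
  have hprod : (∏ s ∈ S.erase a, (σ s - σ a)) * ∏ r ∈ R, (r - σ a) = -1 := by
    rw [← prod_sub_const_erase (σ a), ← prod_image (s := S.erase a) (g := σ)
      (f := fun r => r - σ a) (hσ.mono (by simp)), ← prod_union]
    · refine prod_congr ?_ fun _ _ => rfl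
      ext r
      simp only [hR, mem_union, mem_image, mem_erase, mem_sdiff, mem_univ, true_and, and_true]
      constructor
      · rintro (⟨s, ⟨hsa, hs⟩, rfl⟩ | h)
        · exact fun h => hsa (hσ hs (hES ha) h)
        · rintro rfl
          exact h ⟨a, hES ha, rfl⟩
      · intro h
        by_cases hr : ∃ s ∈ S, σ s = r
        · obtain ⟨s, hs, rfl⟩ := hr
          exact Or.inl ⟨s, ⟨fun h' => h (by rw [h']), hs⟩, rfl⟩
        · exact Or.inr hr
    · rw [disjoint_left]
      rintro r hr hr'
      simp only [hR, mem_sdiff, mem_image] at hr'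
      obtain ⟨s, hs, rfl⟩ := mem_image.1 hr
      exact hr'.2 ⟨s, mem_of_mem_erase hs, rfl⟩
  have hswap (T : Finset F) (x : F) : ∏ r ∈ T, (r - x) = (-1) ^ T.card * ∏ r ∈ T, (x - r) := by
    rw [← prod_const, ← prod_mul_distrib]
    exact prod_congr rfl fun _ _ => by ring
  have hswapE : ∏ z ∈ E.erase a, (σ z - σ a) =
      (-1) ^ R.card * ∏ z ∈ E.erase a, (σ a - σ z) := by
    rw [show R.card = (E.erase a).card by rw [card_erase_of_mem ha]; omega,
      ← prod_const, ← prod_mul_distrib]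
    exact prod_congr rfl fun _ _ => by ring
  have hgev : g.eval (σ a) = ∏ r ∈ R, (σ a - r) := by
    simp [hg, Polynomial.eval_prod]
  rw [hswap] at hprod
  rw [hswapE, hgev]
  have hE0 : ∏ z ∈ E.erase a, (σ a - σ z) ≠ 0 := by
    refine prod_ne_zero_iff.2 fun z hz => sub_ne_zero.2 fun h => ?_
    exact ne_of_mem_erase hz (hE (mem_of_mem_erase hz) ha h.symm)
  refine inv_eq_of_mul_eq_one_right ?_
  have hP := mul_div_cancel₀ (∏ r ∈ R, (σ a - r)) hE0
  linear_combination -(∏ s ∈ S.erase a, (σ s - σ a)) * (-1) ^ R.card * hP - hprod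

theorem sum_inv_prod_bracket {F α : Type*} [Field F] [Fintype F] [DecidableEq F]
    [DecidableEq α] (b : α → α → F) (S E : Finset α) (hES : E ⊆ S) (e₀ e₁ : α)
    (he₀ : e₀ ∈ E) (he₁ : e₁ ∈ E) (hne : e₀ ≠ e₁)
    (hb : ∀ a ∈ S, ∀ s ∈ S, a ≠ s → b a s ≠ 0) (hanti : ∀ a s, b a s = -b s a)
    (hpl : ∀ a s, b a s * b e₀ e₁ = b a e₀ * b s e₁ - b a e₁ * b s e₀)
    (hodd : Odd (Fintype.card F)) (hcard : S.card + E.card = Fintype.card F + 3) :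
    ∑ a ∈ E, ((∏ s ∈ S.erase a, b a s) * ∏ z ∈ E.erase a, b a z)⁻¹ = 0 := by
  have hD : b e₀ e₁ ≠ 0 := hb _ (hES he₀) _ (hES he₁) hne
  set κ := (b e₀ e₁)⁻¹ with hκ
  have hκ0 : κ ≠ 0 := inv_ne_zero hD
  set σ : α → F := fun s => b s e₁ / b s e₀ with hσ
  have hl : ∀ a ∈ S.erase e₀, b a e₀ ≠ 0 := fun a ha =>
    hb _ (mem_of_mem_erase ha) _ (hES he₀) (ne_of_mem_erase ha)
  have hbs : ∀ a ∈ S.erase e₀, ∀ s ∈ S.erase e₀,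
      b a s = (b a e₀ * κ) * b s e₀ * (σ s - σ a) := by
    intro a ha s hs
    have := hpl a s
    have h1 := hl a ha
    have h2 := hl s hs
    simp only [hσ, hκ]
    field_simp
    linear_combination this
  have hinj : Set.InjOn σ (S.erase e₀ : Finset α) := by
    intro a ha s hs h
    by_contra hns
    refine hb a (mem_of_mem_erase ha) s (mem_of_mem_erase hs) hns ?_
    rw [hbs a ha s hs, h, sub_self, mul_zero]
  have hkey : ∀ T ⊆ S, e₀ ∈ T → ∀ a ∈ T.erase e₀, ∏ s ∈ T.erase a, b a s =
      (b a e₀ * κ) ^ ((T.erase e₀).card - 1) * (∏ s ∈ T.erase e₀, b s e₀) *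
        ∏ s ∈ (T.erase e₀).erase a, (σ s - σ a) := by
    intro T hT heT a ha
    have haS : a ∈ S.erase e₀ := erase_subset_erase _ hT ha
    rw [← mul_prod_erase (T.erase a) _ (mem_erase.2 ⟨(ne_of_mem_erase ha).symm, heT⟩),
      ← mul_prod_erase (T.erase e₀) _ ha, erase_right_comm,
      prod_congr rfl fun s hs => hbs a haS s
        (erase_subset_erase _ hT (mem_of_mem_erase hs)),
      prod_mul_distrib, prod_mul_distrib, prod_const, card_erase_of_mem ha]
    ring
  have hS1 : (S.erase e₀).card + 1 = S.card := card_erase_add_one (hES he₀)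
  have hE1 : (E.erase e₀).card + 1 = E.card := card_erase_add_one he₀
  have hmain := sum_inv_prod_sub_mul_prod_sub σ (S.erase e₀) (E.erase e₀)
    (erase_subset_erase _ hES) hinj (by omega)
  set L := (∏ s ∈ S.erase e₀, b s e₀) * ∏ s ∈ E.erase e₀, b s e₀ with hL
  have hterm : ∀ a ∈ E.erase e₀, ((∏ s ∈ S.erase a, b a s) * ∏ z ∈ E.erase a, b a z)⁻¹ =
      L⁻¹ * ((∏ s ∈ (S.erase e₀).erase a, (σ s - σ a)) *
        ∏ z ∈ (E.erase e₀).erase a, (σ z - σ a))⁻¹ := by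
    intro a ha
    have haS := erase_subset_erase e₀ hES ha
    rw [hkey S subset_rfl (hES he₀) a haS, hkey E hES he₀ a ha, ← mul_inv]
    congr 1
    have hpow : (b a e₀ * κ) ^ ((S.erase e₀).card - 1) * (b a e₀ * κ) ^ ((E.erase e₀).card - 1)
        = 1 := by
      rw [← pow_add]
      have h1 : 0 < (E.erase e₀).card := card_pos.2 ⟨a, ha⟩
      have h2 : 0 < (S.erase e₀).card := card_pos.2 ⟨a, haS⟩
      rw [show (S.erase e₀).card - 1 + ((E.erase e₀).card - 1) = Fintype.card F - 1 by omega]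
      exact FiniteField.pow_card_sub_one_eq_one _ (mul_ne_zero (hl a haS) hκ0)
    rw [hL]
    linear_combination (∏ s ∈ S.erase e₀, b s e₀) * (∏ s ∈ E.erase e₀, b s e₀) *
      (∏ s ∈ (S.erase e₀).erase a, (σ s - σ a)) *
        (∏ z ∈ (E.erase e₀).erase a, (σ z - σ a)) * hpow
  rw [← add_sum_erase _ _ he₀, sum_congr rfl hterm, ← mul_sum, hmain]
  have hneg (T : Finset α) : ∏ s ∈ T, b e₀ s = (-1) ^ T.card * ∏ s ∈ T, b s e₀ := by
    rw [← prod_const, ← prod_mul_distrib]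
    exact prod_congr rfl fun s _ => by rw [hanti]; ring
  have hsign : (-1 : F) ^ (S.erase e₀).card * (-1) ^ (E.erase e₀).card = 1 := by
    rw [← pow_add, show (S.erase e₀).card + (E.erase e₀).card = Fintype.card F + 1 by omega]
    exact hodd.add_one.neg_one_pow
  rw [hneg, hneg, show ((-1) ^ (S.erase e₀).card * ∏ s ∈ S.erase e₀, b s e₀) *
      ((-1) ^ (E.erase e₀).card * ∏ s ∈ E.erase e₀, b s e₀) = L by
    rw [hL]
    linear_combination ((∏ s ∈ S.erase e₀, b s e₀) * ∏ s ∈ E.erase e₀, b s e₀) * hsign]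
  ring

theorem card_le_of_bracket {F α : Type*} [Field F] [Fintype F]
    [DecidableEq α] (b : α → α → F) (S : Finset α) (e₀ e₁ : α)
    (he₀ : e₀ ∈ S) (he₁ : e₁ ∈ S) (hne : e₀ ≠ e₁)
    (hb : ∀ a ∈ S, ∀ s ∈ S, a ≠ s → b a s ≠ 0)
    (hpl : ∀ a s, b a s * b e₀ e₁ = b a e₀ * b s e₁ - b a e₁ * b s e₀) :
    S.card ≤ Fintype.card F + 1 := by
  rw [← card_erase_add_one he₀]
  refine Nat.succ_le_succ (Finset.card_le_card_of_injOn (t := univ) (fun s => b s e₁ / b s e₀)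
    (by simp) ?_)
  intro a ha s hs h
  by_contra hns
  have h1 := hb a (mem_of_mem_erase ha) e₀ he₀ (ne_of_mem_erase ha)
  have h2 := hb s (mem_of_mem_erase hs) e₀ he₀ (ne_of_mem_erase hs)
  refine mul_ne_zero (hb a (mem_of_mem_erase ha) s (mem_of_mem_erase hs) hns)
    (hb e₀ he₀ e₁ he₁ hne) ?_
  rw [hpl]
  simp only at h
  field_simp at h
  linear_combination -h

/-- Summing a function over the pairs `(T, x)` with `T` an `n`-subset and `x ∉ T` is the same as
summing it over the pairs `(T, x)` with `T` an `(n + 1)`-subset and `x ∈ T`. -/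
theorem sum_powersetCard_sum_insert {F α : Type*} [CommRing F] [DecidableEq α] (N : Finset α)
    (n : ℕ) (f c : Finset α → F) :
    ∑ T ∈ N.powersetCard n, f T * ∑ x ∈ N \ T, c (insert x T) =
      ∑ T ∈ N.powersetCard (n + 1), (∑ x ∈ T, f (T.erase x)) * c T := by
  simp_rw [mul_sum, sum_mul]
  rw [sum_sigma', sum_sigma']
  refine sum_bij' (fun z _ => ⟨insert z.2 z.1, z.2⟩) (fun z _ => ⟨z.1.erase z.2, z.2⟩)
    ?_ ?_ ?_ ?_ ?_
  · rintro ⟨T, x⟩ h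
    simp only [mem_sigma, mem_powersetCard, mem_sdiff] at h ⊢
    exact ⟨⟨insert_subset h.2.1 h.1.1, by rw [card_insert_of_notMem h.2.2, h.1.2]⟩,
      mem_insert_self _ _⟩
  · rintro ⟨T, x⟩ h
    simp only [mem_sigma, mem_powersetCard, mem_sdiff] at h ⊢
    exact ⟨⟨(erase_subset _ _).trans h.1.1, by rw [card_erase_of_mem h.2, h.1.2]; rfl⟩,
      h.1.1 h.2, notMem_erase _ _⟩
  · rintro ⟨T, x⟩ h
    simp only [mem_sigma, mem_sdiff] at h
    simp [erase_insert h.2.2]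
  · rintro ⟨T, x⟩ h
    simp only [mem_sigma] at h
    simp [insert_erase h.2]
  · rintro ⟨T, x⟩ h
    simp only [mem_sigma, mem_sdiff] at h
    simp [erase_insert h.2.2]

theorem eq_zero_of_sum_insert_eq_zero {F α : Type*} [Field F] [DecidableEq α] (n : ℕ)
    (hn : ((n + 1).factorial : F) ≠ 0) (N : Finset α) (hN : N.card = 2 * n + 1)
    (c : Finset α → F)
    (hc : ∀ T ⊆ N, T.card = n → ∑ x ∈ N \ T, c (insert x T) = 0)
    (E : Finset α) (hEN : E ⊆ N) (hE : E.card = n + 1) : c E = 0 := by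
  set w : ℕ → F := fun i => (-1) ^ i * (i.factorial * (n - i).factorial : ℕ) with hw
  have h := sum_powersetCard_sum_insert N n (fun T => w (T ∩ E).card) c
  rw [sum_eq_zero fun T hT => by
    rw [hc T (mem_powersetCard.1 hT).1 (mem_powersetCard.1 hT).2, mul_zero]] at h
  have hinner : ∀ T : Finset α, ∑ x ∈ T, w (T.erase x ∩ E).card =
      (T ∩ E).card * w ((T ∩ E).card - 1) + (T \ E).card * w (T ∩ E).card := by
    intro T
    rw [← sum_inter_add_sum_sdiff T E]
    congr 1
    · rw [sum_congr rfl (g := fun _ => w ((T ∩ E).card - 1)), sum_const, nsmul_eq_mul]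
      intro x hx
      rw [erase_inter, card_erase_of_mem hx]
    · rw [sum_congr rfl (g := fun _ => w (T ∩ E).card), sum_const, nsmul_eq_mul]
      intro x hx
      rw [erase_inter, erase_eq_of_notMem]
      exact fun h => (mem_sdiff.1 hx).2 (mem_inter.1 h).2
  have hsingle : ∑ T ∈ N.powersetCard (n + 1), (∑ x ∈ T, w (T.erase x ∩ E).card) * c T =
      (∑ x ∈ E, w (E.erase x ∩ E).card) * c E := by
    refine sum_eq_single_of_mem E (mem_powersetCard.2 ⟨hEN, hE⟩) ?_
    intro T hT hTE
    obtain ⟨hTN, hTc⟩ := mem_powersetCard.1 hT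
    rw [hinner]
    have h1 : (T ∩ E).card + (T \ E).card = n + 1 := by rw [card_inter_add_card_sdiff, hTc]
    have h2 : 0 < (T ∩ E).card := by
      have h3 := card_union_add_card_inter T E
      have h4 := card_le_card (union_subset hTN hEN)
      omega
    have h3 : 0 < (T \ E).card := by
      rw [card_pos, sdiff_nonempty]
      exact fun hs => hTE (eq_of_subset_of_card_le hs (by omega))
    generalize (T ∩ E).card = i at *
    generalize (T \ E).card = j at *
    obtain ⟨i, rfl⟩ := Nat.exists_eq_succ_of_ne_zero h2.ne'
    obtain ⟨j, rfl⟩ := Nat.exists_eq_succ_of_ne_zero h3.ne'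
    obtain rfl : n = i + j + 1 := by omega
    simp only [hw, Nat.succ_eq_add_one, Nat.add_sub_cancel,
      show i + j + 1 - i = j + 1 by omega, show i + j + 1 - (i + 1) = j by omega,
      Nat.factorial_succ]
    push_cast
    ring
  rw [hsingle, hinner] at h
  simp only [inter_self, hE, sdiff_self, bot_eq_empty, card_empty, Nat.cast_zero, zero_mul, add_zero,
    Nat.add_sub_cancel, hw, Nat.sub_self, Nat.factorial_zero, mul_one] at h
  rw [Nat.factorial_succ] at hn
  push_cast at hn
  have : ((n : F) + 1) * ((-1) ^ n * n.factorial) ≠ 0 := by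
    have h1 : (-1 : F) ^ n ≠ 0 := by simp
    rw [mul_left_comm]
    exact mul_ne_zero h1 hn
  push_cast at h
  exact (mul_eq_zero.1 h.symm).resolve_left this

/-- The union of the pairs in a list. -/
def pairSupport {α : Type*} [DecidableEq α] : List (α × α) → Finset α
  | [] => ∅
  | (b, b') :: l => insert b (insert b' (pairSupport l))

/-- The pairs in a list are disjoint and consist of distinct elements. -/
def DisjointPairs {α : Type*} [DecidableEq α] : List (α × α) → Prop
  | [] => True
  | (b, b') :: l => b ≠ b' ∧ b ∉ pairSupport l ∧ b' ∉ pairSupport l ∧ DisjointPairs l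

/-- The alternating sum of `β` over the sets obtained by adding to a set one element of each
pair, with a sign for every second element chosen. -/
def alternatingSum {F α : Type*} [CommRing F] [DecidableEq α] :
    List (α × α) → (Finset α → F) → Finset α → F
  | [], β => β
  | (b, b') :: l, β => alternatingSum l fun C => β (insert b C) - β (insert b' C)

section alternatingSum

variable {F α : Type*} [CommRing F] [DecidableEq α]

theorem exists_disjointPairs (r : ℕ) (P : Finset α) (hP : P.card = 2 * r) :
    ∃ l : List (α × α), l.length = r ∧ DisjointPairs l ∧ pairSupport l = P := by
  induction r generalizing P with
  | zero =>
    refine ⟨[], rfl, trivial, ?_⟩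
    rw [card_eq_zero.1 hP]; rfl
  | succ r ih =>
    obtain ⟨b, Q, hb, rfl, hQ⟩ := card_eq_succ.1 (show P.card = 2 * r + 1 + 1 by omega)
    obtain ⟨b', R, hb', rfl, hR⟩ := card_eq_succ.1 hQ
    obtain ⟨l, hl, hd, rfl⟩ := ih R hR
    simp only [mem_insert, not_or] at hb
    exact ⟨(b, b') :: l, by simp [hl], ⟨hb.1, hb.2, hb', hd⟩, rfl⟩

theorem fst_mem_pairSupport {l : List (α × α)} {x : α × α} (hx : x ∈ l) :
    x.1 ∈ pairSupport l := by
  induction l with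
  | nil => simp at hx
  | cons y l ih =>
    rcases List.mem_cons.1 hx with rfl | hx
    · simp [pairSupport]
    · simp [pairSupport, ih hx]

theorem snd_mem_pairSupport {l : List (α × α)} {x : α × α} (hx : x ∈ l) :
    x.2 ∈ pairSupport l := by
  induction l with
  | nil => simp at hx
  | cons y l ih =>
    rcases List.mem_cons.1 hx with rfl | hx
    · simp [pairSupport]
    · simp [pairSupport, ih hx]

theorem alternatingSum_congr (l : List (α × α)) (hl : DisjointPairs l) (β β' : Finset α → F)
    (C : Finset α) (hC : Disjoint C (pairSupport l))
    (h : ∀ D, C ⊆ D → D ⊆ C ∪ pairSupport l → D.card = C.card + l.length → β D = β' D) :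
    alternatingSum l β C = alternatingSum l β' C := by
  induction l generalizing β β' with
  | nil => exact h C subset_rfl subset_union_left rfl
  | cons x l ih =>
    obtain ⟨b, b'⟩ := x
    obtain ⟨-, hb, hb', hd⟩ := hl
    simp only [pairSupport, disjoint_insert_right] at hC
    refine ih hd _ _ hC.2.2 fun D hCD hD hDc => ?_
    have key : ∀ x, x ∉ C → x ∉ pairSupport l → x ∈ ({b, b'} : Finset α) →
        β (insert x D) = β' (insert x D) := by
      intro x hxC hxl hx
      have hxD : x ∉ D := fun h => by
        rcases mem_union.1 (hD h) with h | h
        exacts [hxC h, hxl h]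
      refine h _ (hCD.trans (subset_insert _ _)) ?_ ?_
      · intro y hy
        simp only [mem_insert, mem_singleton, mem_union, pairSupport] at hx hy ⊢
        rcases hy with rfl | hy
        · tauto
        · rcases mem_union.1 (hD hy) with h | h <;> tauto
      · rw [card_insert_of_notMem hxD, hDc, List.length_cons]; ring
    rw [key b hC.1 hb (by simp), key b' hC.2.1 hb' (by simp)]

theorem alternatingSum_sum {ι : Type*} (l : List (α × α)) (t : Finset ι) (a : ι → F)
    (β : ι → Finset α → F) (C : Finset α) :
    alternatingSum l (fun D => ∑ i ∈ t, a i * β i D) C =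
      ∑ i ∈ t, a i * alternatingSum l (β i) C := by
  induction l generalizing β with
  | nil => rfl
  | cons x l ih =>
    simp only [alternatingSum]
    rw [← ih]
    simp_rw [mul_sub, sum_sub_distrib]

theorem alternatingSum_eq_of_vanish (l : List (α × α)) (β : Finset α → F) (C : Finset α)
    (h : ∀ x ∈ l, ∀ D, x.2 ∈ D → β D = 0) :
    alternatingSum l β C = β ((l.map Prod.fst).toFinset ∪ C) := by
  induction l generalizing β with
  | nil => simp [alternatingSum]
  | cons x l ih =>
    obtain ⟨b, b'⟩ := x
    simp only [alternatingSum]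
    have h0 : ∀ D, β (insert b' D) = 0 := fun D => h (b, b') (by simp) _ (mem_insert_self _ _)
    simp_rw [h0, sub_zero]
    rw [ih]
    · simp [insert_union]
    · exact fun x hx D hD => h x (by simp [hx]) _ (mem_insert_of_mem hD)

theorem sum_alternatingSum_insert (l : List (α × α)) (hl : DisjointPairs l) (n : ℕ)
    (N : Finset α) (hN : Disjoint N (pairSupport l)) (β : Finset α → F)
    (hβ : ∀ Y ⊆ N ∪ pairSupport l, Y.card = n + l.length →
      ∑ a ∈ (N ∪ pairSupport l) \ Y, β (insert a Y) = 0)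
    (T : Finset α) (hT : T ⊆ N) (hTc : T.card = n) :
    ∑ a ∈ N \ T, alternatingSum l β (insert a T) = 0 := by
  induction l generalizing β with
  | nil => simpa [alternatingSum, pairSupport] using hβ T (hT.trans subset_union_left) hTc
  | cons x l ih =>
    obtain ⟨b, b'⟩ := x
    obtain ⟨hbb, hb, hb', hd⟩ := hl
    simp only [pairSupport, disjoint_insert_right] at hN
    refine ih hd hN.2.2 _ fun Y hY hYc => ?_
    have hnot : ∀ x, x ∉ N → x ∉ pairSupport l → x ∉ N ∪ pairSupport l := by
      intro x h1 h2 h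
      exact (mem_union.1 h).elim h1 h2
    have key : ∀ x y, x ≠ y → x ∉ N ∪ pairSupport l → y ∉ N ∪ pairSupport l →
        N ∪ pairSupport ((b, b') :: l) = insert x (insert y (N ∪ pairSupport l)) →
        ∑ a ∈ (N ∪ pairSupport l) \ Y, β (insert x (insert a Y)) =
          - β (insert x (insert y Y)) := by
      intro x y hxy hx hy hset
      have h := hβ (insert x Y)
        (hset ▸ insert_subset_insert _ (hY.trans (subset_insert _ _)))
        (by rw [card_insert_of_notMem (fun h => hx (hY h)), hYc, List.length_cons]; ring)
      have hsd : (N ∪ pairSupport ((b, b') :: l)) \ insert x Y =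
          insert y ((N ∪ pairSupport l) \ Y) := by
        rw [hset]
        ext z
        simp only [mem_sdiff, mem_insert]
        constructor
        · tauto
        · rintro (rfl | ⟨h1, h2⟩)
          · exact ⟨by tauto, by rintro (h | h); exacts [hxy h.symm, hy (hY h)]⟩
          · exact ⟨by tauto, by rintro (rfl | h); exacts [hx h1, h2 h]⟩
      rw [hsd, sum_insert (fun h => hy (mem_sdiff.1 h).1)] at h
      simp_rw [Finset.insert_comm _ x] at h
      exact eq_neg_of_add_eq_zero_right h
    have hbN := hnot b hN.1 hb
    have hbN' := hnot b' hN.2.1 hb'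
    rw [sum_sub_distrib, key b b' hbb hbN hbN' (by simp [pairSupport, union_insert]),
      key b' b hbb.symm hbN' hbN (by simp [pairSupport, union_insert, Finset.insert_comm]),
      Finset.insert_comm, sub_self]

end alternatingSum

section Arc

variable {F : Type*} [Field F]

/-- A set of vectors of `F ^ k` all of whose subsets of size `k` are bases. -/
def IsArc {k : ℕ} (S : Finset (Fin k → F)) : Prop :=
  ∀ A ⊆ S, A.card = k →
    LinearIndependent F (fun v : {x // x ∈ A} => (v : Fin k → F)) ∧
    Submodule.span F (A : Set (Fin k → F)) = ⊤

/-- The linear form `v ↦ det (v, c₁, …, cₙ)`. -/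
noncomputable def detForm {n : ℕ} (c : Fin n → Fin (n + 1) → F) :
    (Fin (n + 1) → F) →ₗ[F] F where
  toFun v := Matrix.detRowAlternating.curryLeft v c
  map_add' v w := by simp only [map_add, AlternatingMap.add_apply]
  map_smul' a v := by
    simp only [map_smul, AlternatingMap.smul_apply, RingHom.id_apply]

/-- A linear form whose kernel is spanned by `C` if `C` consists of `n` independent vectors of
`F ^ (n + 1)`, normalised up to sign by a determinant. -/
noncomputable def spanForm {n : ℕ} (C : Finset (Fin (n + 1) → F)) :
    (Fin (n + 1) → F) →ₗ[F] F :=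
  if h : C.card = n then detForm fun i => ((C.equivFinOfCardEq h).symm i : Fin (n + 1) → F) else 0

theorem detForm_apply {n : ℕ} (c : Fin n → Fin (n + 1) → F) (v : Fin (n + 1) → F) :
    detForm c v = Matrix.detRowAlternating (Matrix.vecCons v c) := rfl

theorem detForm_self {n : ℕ} (c : Fin n → Fin (n + 1) → F) (i : Fin n) :
    detForm c (c i) = 0 := by
  rw [detForm_apply]
  exact AlternatingMap.map_eq_zero_of_eq _ _ (i := 0) (j := i.succ) (by simp)
    (Fin.succ_ne_zero i).symm

theorem detForm_comp_perm {n : ℕ} (c : Fin n → Fin (n + 1) → F) (σ : Equiv.Perm (Fin n)) :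
    ∃ ε : F, ε ^ 2 = 1 ∧ ∀ v, detForm (c ∘ σ) v = ε * detForm c v := by
  refine ⟨((Equiv.Perm.sign σ : ℤ) : F), ?_, fun v => ?_⟩
  · rcases Int.units_eq_one_or (Equiv.Perm.sign σ) with h | h <;> simp [h]
  · have := (Matrix.detRowAlternating (R := F) (n := Fin (n + 1))).curryLeft v |>.map_perm c σ
    change ((Matrix.detRowAlternating (R := F) (n := Fin (n + 1))).curryLeft v) (c ∘ σ) = _
    rw [this, Units.smul_def, zsmul_eq_mul]
    rfl

theorem spanForm_eq_detForm {n : ℕ} (c : Fin n → Fin (n + 1) → F) (hc : Function.Injective c)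
    (C : Finset (Fin (n + 1) → F)) (hC : ∀ v, v ∈ C ↔ ∃ i, c i = v) :
    ∃ ε : F, ε ^ 2 = 1 ∧ ∀ v, spanForm C v = ε * detForm c v := by
  classical
  have hCi : C = univ.image c := by ext v; simp [hC]
  have hcard : C.card = n := by rw [hCi, card_image_of_injective _ hc]; simp
  have hmem (i : Fin n) : ((C.equivFinOfCardEq hcard).symm i : Fin (n + 1) → F) ∈ C :=
    Subtype.prop _
  choose σ hσ using fun i => (hC _).1 (hmem i)
  have hinj : Function.Injective σ := by
    intro i j hij
    have := (hσ i).symm.trans ((congrArg c hij).trans (hσ j))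
    exact (C.equivFinOfCardEq hcard).symm.injective (Subtype.ext this)
  obtain ⟨ε, hε, h⟩ := detForm_comp_perm c
    (Equiv.ofBijective σ (Finite.injective_iff_bijective.1 hinj))
  refine ⟨ε, hε, fun v => ?_⟩
  rw [← h v, spanForm, dif_pos hcard]
  congr 2
  funext i
  exact (hσ i).symm

theorem spanForm_self {n : ℕ} (C : Finset (Fin (n + 1) → F)) (v : Fin (n + 1) → F) (hv : v ∈ C) :
    spanForm C v = 0 := by
  rw [spanForm]
  split_ifs with h
  · have := detForm_self (fun i => ((C.equivFinOfCardEq h).symm i : Fin (n + 1) → F))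
      (C.equivFinOfCardEq h ⟨v, hv⟩)
    simpa using this
  · rfl

theorem spanForm_eq_zero_of_mem_span {n : ℕ} (C : Finset (Fin (n + 1) → F))
    (v : Fin (n + 1) → F) (hv : v ∈ Submodule.span F (C : Set (Fin (n + 1) → F))) :
    spanForm C v = 0 := by
  have : Submodule.span F (C : Set (Fin (n + 1) → F)) ≤ LinearMap.ker (spanForm C) :=
    Submodule.span_le.2 fun w hw => spanForm_self C w hw
  exact this hv

theorem IsArc.spanForm_ne_zero [DecidableEq F] {n : ℕ} {S : Finset (Fin (n + 1) → F)}
    (hS : IsArc S)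
    {C : Finset (Fin (n + 1) → F)} (hCS : C ⊆ S) (hC : C.card = n) {s : Fin (n + 1) → F}
    (hs : s ∈ S) (hsC : s ∉ C) : spanForm C s ≠ 0 := by
  intro h0
  obtain ⟨-, hspan⟩ := hS (insert s C) (insert_subset hs hCS) (by rw [card_insert_of_notMem hsC, hC])
  have hker : ∀ v, spanForm C v = 0 := by
    intro v
    have hv : v ∈ Submodule.span F ((insert s C : Finset _) : Set (Fin (n + 1) → F)) := by
      rw [hspan]; trivial
    have : Submodule.span F ((insert s C : Finset _) : Set (Fin (n + 1) → F)) ≤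
        LinearMap.ker (spanForm C) := by
      refine Submodule.span_le.2 fun w hw => ?_
      rcases mem_insert.1 (mem_coe.1 hw) with rfl | hw
      exacts [h0, spanForm_self C w hw]
    exact this hv
  obtain ⟨hli, -⟩ := hS (insert s C) (insert_subset hs hCS) (by rw [card_insert_of_notMem hsC, hC])
  rw [spanForm, dif_pos hC, detForm_apply] at h0
  set c : Fin n → Fin (n + 1) → F := fun i => ((C.equivFinOfCardEq hC).symm i : Fin (n + 1) → F)
  have hcinj : Function.Injective c := fun i j hij =>
    (C.equivFinOfCardEq hC).symm.injective (Subtype.ext hij)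
  have hcC : ∀ i, c i ∈ C := fun i => Subtype.prop _
  have hmem : ∀ i, Matrix.vecCons s c i ∈ insert s C := by
    intro i
    refine Fin.cases ?_ (fun j => ?_) i
    · simp
    · simp [hcC j]
  have hinj : Function.Injective (Matrix.vecCons s c) := by
    intro i j
    refine Fin.cases ?_ (fun i => ?_) i <;> refine Fin.cases ?_ (fun j => ?_) j
    · simp
    · intro h
      simp only [Matrix.cons_val_zero, Matrix.cons_val_succ] at h
      exact absurd (h ▸ hcC j) hsC
    · intro h
      simp only [Matrix.cons_val_zero, Matrix.cons_val_succ] at h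
      exact absurd (h ▸ hcC i) hsC
    · intro h
      simp only [Matrix.cons_val_succ] at h
      rw [hcinj h]
  have hli' : LinearIndependent F (Matrix.vecCons s c) :=
    hli.comp (fun i => (⟨Matrix.vecCons s c i, hmem i⟩ : {x // x ∈ insert s C}))
      fun i j h => hinj (congrArg Subtype.val h)
  have hunit := (Matrix.linearIndependent_rows_iff_isUnit (A := Matrix.of (Matrix.vecCons s c))).1 hli'
  rw [Matrix.isUnit_iff_isUnit_det] at hunit
  exact hunit.ne_zero h0

theorem exists_bracket [DecidableEq F] {n : ℕ} (Y : Finset (Fin (n + 2) → F)) (hY : Y.card = n) :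
    ∃ L : (Fin (n + 2) → F) → (Fin (n + 2) → F) →ₗ[F] F,
      (∀ a, L a a = 0) ∧ (∀ a s, L a s = -L s a) ∧ (∀ a, ∀ y ∈ Y, L a y = 0) ∧
      ∀ a ∉ Y, ∃ ε : F, ε ^ 2 = 1 ∧ ∀ s, spanForm (insert a Y) s = ε * L a s := by
  set y : Fin n → Fin (n + 2) → F := fun i => ((Y.equivFinOfCardEq hY).symm i : Fin (n + 2) → F)
    with hy
  have hyinj : Function.Injective y := fun i j hij =>
    (Y.equivFinOfCardEq hY).symm.injective (Subtype.ext hij)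
  have hyY : ∀ v, v ∈ Y ↔ ∃ i, y i = v := fun v =>
    ⟨fun hv => ⟨Y.equivFinOfCardEq hY ⟨v, hv⟩, by simp [hy]⟩, by rintro ⟨i, rfl⟩; exact Subtype.prop _⟩
  refine ⟨fun a => detForm (Matrix.vecCons a y), fun a => ?_, fun a s => ?_, fun a v hv => ?_, fun a ha => ?_⟩
  · exact detForm_self (Matrix.vecCons a y) 0
  · rw [detForm_apply, detForm_apply, ← AlternatingMap.map_swap (i := 0) (j := 1) _ _ (by simp)]
    congr 1
    funext i
    refine Fin.cases ?_ (fun i => Fin.cases ?_ (fun i => ?_) i) i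
    · simp
    · simp
    · rw [Function.comp_apply, Equiv.swap_apply_of_ne_of_ne]
      · simp
      · exact Fin.succ_ne_zero _
      · intro h
        exact Fin.succ_ne_zero i (Fin.succ_injective _ h)
  · obtain ⟨i, rfl⟩ := (hyY v).1 hv
    have := detForm_self (Matrix.vecCons a y) i.succ
    simpa using this
  · refine spanForm_eq_detForm _ ?_ _ fun v => ?_
    · intro i j
      refine Fin.cases ?_ (fun i => ?_) i <;> refine Fin.cases ?_ (fun j => ?_) j
      · simp
      · intro h
        simp only [Matrix.cons_val_zero, Matrix.cons_val_succ] at h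
        exact absurd ((hyY a).2 ⟨j, h.symm⟩) ha
      · intro h
        simp only [Matrix.cons_val_zero, Matrix.cons_val_succ] at h
        exact absurd ((hyY a).2 ⟨i, h⟩) ha
      · intro h
        simp only [Matrix.cons_val_succ] at h
        rw [hyinj h]
    · rw [mem_insert, Fin.exists_fin_succ, hyY]
      simp [eq_comm]

theorem bracket_plucker {V : Type*} [AddCommGroup V] [Module F V] (L : V → V →ₗ[F] F)
    (hanti : ∀ a s, L a s = -L s a) (Y : Set V) (hY : ∀ a, ∀ y ∈ Y, L a y = 0) (e₀ e₁ : V)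
    (h₀ : L e₀ e₀ = 0) (h₁ : L e₁ e₁ = 0)
    (hspan : Submodule.span F (insert e₀ (insert e₁ Y)) = ⊤) (a s : V) :
    L a s * L e₀ e₁ = L a e₀ * L s e₁ - L a e₁ * L s e₀ := by
  have hs : s ∈ Submodule.span F (insert e₀ (insert e₁ Y)) := by rw [hspan]; trivial
  obtain ⟨x, u, hu, rfl⟩ := Submodule.mem_span_insert.1 hs
  obtain ⟨x', w, hw, rfl⟩ := Submodule.mem_span_insert.1 hu
  have hw0 : ∀ t, L t w = 0 := fun t =>
    (Submodule.span_le (p := LinearMap.ker (L t))).2 (fun y hy => hY t y hy) hw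
  rw [hanti (x • e₀ + (x' • e₁ + w)) e₁, hanti (x • e₀ + (x' • e₁ + w)) e₀]
  simp only [map_add, map_smul, smul_eq_mul, hw0, h₀, h₁]
  rw [hanti e₁ e₀]
  ring

theorem IsArc.exists_bracket [DecidableEq F] {n : ℕ} {S : Finset (Fin (n + 2) → F)}
    (hS : IsArc S) (Y : Finset (Fin (n + 2) → F)) (hYS : Y ⊆ S) (hY : Y.card = n)
    (e₀ e₁ : Fin (n + 2) → F) (he₀ : e₀ ∈ S \ Y) (he₁ : e₁ ∈ S \ Y) (hne : e₀ ≠ e₁) :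
    ∃ b : (Fin (n + 2) → F) → (Fin (n + 2) → F) → F,
      (∀ a s, b a s = -b s a) ∧
      (∀ a s, b a s * b e₀ e₁ = b a e₀ * b s e₁ - b a e₁ * b s e₀) ∧
      (∀ a ∈ S \ Y, ∀ s ∈ S \ Y, a ≠ s → b a s ≠ 0) ∧
      ∀ a ∉ Y, ∃ ε : F, ε ^ 2 = 1 ∧ ∀ s, spanForm (insert a Y) s = ε * b a s := by
  obtain ⟨L, hself, hanti, hLY, hL⟩ := _root_.exists_bracket Y hY
  refine ⟨fun a s => L a s, hanti, ?_, ?_, hL⟩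
  · refine bracket_plucker L hanti (Y : Set _) hLY e₀ e₁ (hself _) (hself _) ?_
    rw [mem_sdiff] at he₀ he₁
    have := (hS (insert e₀ (insert e₁ Y))
      (insert_subset he₀.1 (insert_subset he₁.1 hYS)) (by
        rw [card_insert_of_notMem (by simp [hne, he₀.2]), card_insert_of_notMem he₁.2, hY])).2
    rwa [coe_insert, coe_insert] at this
  · intro a ha s hs hne h0
    rw [mem_sdiff] at ha hs
    obtain ⟨ε, -, h⟩ := hL a ha.2
    refine hS.spanForm_ne_zero (insert_subset ha.1 hYS)
      (by rw [card_insert_of_notMem ha.2, hY]) hs.1 (by simp [hne.symm, hs.2]) ?_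
    rw [h]
    simp only at h0
    rw [h0, mul_zero]

theorem IsArc.card_le_of_dim_two [Fintype F] [DecidableEq F] {S : Finset (Fin 2 → F)}
    (hS : IsArc S) : S.card ≤ Fintype.card F + 1 := by
  rcases Nat.lt_or_ge 1 S.card with h | h
  · obtain ⟨e₀, he₀, e₁, he₁, hne⟩ := one_lt_card.1 h
    obtain ⟨b, -, hpl, hb, -⟩ := hS.exists_bracket ∅ (empty_subset _) rfl e₀ e₁
      (by simpa using he₀) (by simpa using he₁) hne
    rw [sdiff_empty] at hb
    exact card_le_of_bracket b S e₀ e₁ he₀ he₁ hne hb hpl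
  · omega

/-- The weight of `C` relative to the sets `S` and `W`. -/
noncomputable def arcWeight [DecidableEq F] {n : ℕ} (S W C : Finset (Fin (n + 1) → F)) : F :=
  ((∏ s ∈ S \ C, spanForm C s) * ∏ z ∈ W \ C, spanForm C z)⁻¹

theorem IsArc.sum_arcWeight [Fintype F] [DecidableEq F] {n : ℕ} (hn : 1 ≤ n)
    (hodd : Odd (Fintype.card F)) {S : Finset (Fin (n + 2) → F)} (hS : IsArc S)
    (hcard : S.card = Fintype.card F + 2) (W : Finset (Fin (n + 2) → F)) (hWS : W ⊆ S)
    (hW : W.card = 2 * n + 1) (Y : Finset (Fin (n + 2) → F)) (hYW : Y ⊆ W) (hY : Y.card = n) :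
    ∑ a ∈ W \ Y, arcWeight S W (insert a Y) = 0 := by
  have hWY : (W \ Y).card = n + 1 := by rw [card_sdiff_of_subset hYW]; omega
  have hSY : (S \ Y).card + n = Fintype.card F + 2 := by
    rw [card_sdiff_of_subset (hYW.trans hWS)]
    have := card_le_card (hYW.trans hWS)
    omega
  obtain ⟨e₀, he₀, e₁, he₁, hne⟩ := one_lt_card.1 (show 1 < (W \ Y).card by omega)
  have hsub : W \ Y ⊆ S \ Y := sdiff_subset_sdiff hWS subset_rfl
  obtain ⟨b, hanti, hpl, hb, hL⟩ := hS.exists_bracket Y (hYW.trans hWS) hY e₀ e₁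
    (hsub he₀) (hsub he₁) hne
  rw [← sum_inv_prod_bracket b (S \ Y) (W \ Y) hsub e₀ e₁ he₀ he₁ hne hb hanti hpl hodd
    (by omega)]
  refine sum_congr rfl fun a ha => ?_
  obtain ⟨ε, hε, h⟩ := hL a (mem_sdiff.1 ha).2
  rw [arcWeight, sdiff_insert, sdiff_insert]
  simp_rw [h, prod_mul_distrib, prod_const]
  congr 1
  have hpow : ε ^ ((S \ Y).erase a).card * ε ^ ((W \ Y).erase a).card = 1 := by
    rw [← pow_add, card_erase_of_mem ha, card_erase_of_mem (hsub ha)]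
    obtain ⟨q, hq⟩ := hodd
    have hpos := card_pos.2 ⟨a, hsub ha⟩
    rw [show (S \ Y).card - 1 + ((W \ Y).card - 1) = 2 * (q + 1) by omega, pow_mul, hε, one_pow]
  linear_combination (∏ s ∈ (S \ Y).erase a, b a s) * (∏ z ∈ (W \ Y).erase a, b a z) * hpow

/-- A spanning family of linear forms may be moved from the denominator to the numerator: if the
alternating sums with `n` forms in the denominator vanish, so do those with `n + j` forms in the
denominator and `j` arbitrary linear forms in the numerator. -/
theorem IsArc.alternatingSum_mul_prod [DecidableEq F] {n r : ℕ} (hr : r ≤ n)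
    {S : Finset (Fin (n + r + 2) → F)} (hS : IsArc S)
    (l : List ((Fin (n + r + 2) → F) × (Fin (n + r + 2) → F))) (hl : DisjointPairs l)
    (hlr : l.length = r)
    (E X : Finset (Fin (n + r + 2) → F)) (hES : E ⊆ S) (hlS : pairSupport l ⊆ S) (hXS : X ⊆ S)
    (hE : E.card = n + 1) (hEl : Disjoint E (pairSupport l)) (hEX : Disjoint E X)
    (hXl : Disjoint X (pairSupport l)) (ρ : Finset (Fin (n + r + 2) → F) → F)
    (h0 : ∀ Y ⊆ X, Y.card = n →
      alternatingSum l (fun C => ρ C * (∏ x ∈ Y, spanForm C x)⁻¹) E = 0)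
    (vs : List (Fin (n + r + 2) → F)) (Y : Finset (Fin (n + r + 2) → F)) (hYX : Y ⊆ X)
    (hY : Y.card = n + vs.length) :
    alternatingSum l
      (fun C => ρ C * (vs.map (spanForm C)).prod * (∏ x ∈ Y, spanForm C x)⁻¹) E = 0 := by
  induction vs generalizing Y with
  | nil => simpa using h0 Y hYX hY
  | cons v vs ih =>
    rw [List.length_cons] at hY
    obtain ⟨Z, hZY, hZ⟩ := exists_subset_card_eq (show r + 1 ≤ Y.card by omega)
    have hEZ : Disjoint E Z := disjoint_of_subset_right (hZY.trans hYX) hEX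
    have hspan := (hS (E ∪ Z) (union_subset hES ((hZY.trans hYX).trans hXS))
      (by rw [card_union_of_disjoint hEZ, hE, hZ]; omega)).2
    have hv : v ∈ Submodule.span F ((E ∪ Z : Finset _) : Set (Fin (n + r + 2) → F)) := by
      rw [hspan]; trivial
    rw [coe_union, Submodule.span_union] at hv
    obtain ⟨u, hu, w, hw, rfl⟩ := Submodule.mem_sup.1 hv
    obtain ⟨f, -, rfl⟩ := Submodule.mem_span_finset.1 hw
    rw [alternatingSum_congr l hl _ (fun C => ∑ z ∈ Z, f z *
      (ρ C * (vs.map (spanForm C)).prod * (∏ x ∈ Y.erase z, spanForm C x)⁻¹)) E hEl,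
      alternatingSum_sum]
    · refine sum_eq_zero fun z hz => ?_
      rw [ih _ ((erase_subset _ _).trans hYX), mul_zero]
      rw [card_erase_of_mem (hZY hz), hY]
      omega
    · intro D hED hDE hD
      have hDS : D ⊆ S := hDE.trans (union_subset hES hlS)
      have hu0 : spanForm D u = 0 :=
        spanForm_eq_zero_of_mem_span D u (Submodule.span_mono (coe_subset.2 hED) hu)
      simp only [List.map_cons, List.prod_cons, map_add, hu0, zero_add, map_sum, map_smul,
        smul_eq_mul, mul_sum, sum_mul]
      refine sum_congr rfl fun z hz => ?_
      have hzX := hYX (hZY hz)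
      have hzD : z ∉ D := fun h => (mem_union.1 (hDE h)).elim
        (fun h => disjoint_left.1 hEX h hzX) (disjoint_left.1 hXl hzX)
      have hz0 : spanForm D z ≠ 0 := hS.spanForm_ne_zero hDS (by omega) (hXS hzX) hzD
      rw [← mul_prod_erase Y _ (hZY hz), mul_inv]
      field_simp

theorem DisjointPairs.card_fst {α : Type*} [DecidableEq α] {l : List (α × α)}
    (hl : DisjointPairs l) : (l.map Prod.fst).toFinset.card = l.length := by
  induction l with
  | nil => rfl
  | cons x l ih =>
    obtain ⟨b, b'⟩ := x
    obtain ⟨-, hb, -, hd⟩ := hl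
    rw [List.map_cons, List.toFinset_cons, card_insert_of_notMem, ih hd, List.length_cons]
    intro h
    obtain ⟨y, hy, rfl⟩ := List.mem_map.1 (List.mem_toFinset.1 h)
    exact hb (fst_mem_pairSupport hy)

theorem DisjointPairs.fst_ne_snd {α : Type*} [DecidableEq α] {l : List (α × α)}
    (hl : DisjointPairs l) {x y : α × α} (hx : x ∈ l) (hy : y ∈ l) : x.1 ≠ y.2 := by
  induction l with
  | nil => simp at hx
  | cons z l ih =>
    obtain ⟨b, b'⟩ := z
    obtain ⟨hbb, hb, hb', hd⟩ := hl
    rcases List.mem_cons.1 hx with rfl | hx <;> rcases List.mem_cons.1 hy with rfl | hy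
    · exact hbb
    · exact fun h => hb ((show b = y.2 from h).symm ▸ snd_mem_pairSupport hy)
    · exact fun h => hb' ((show x.1 = b' from h) ▸ fst_mem_pairSupport hx)
    · exact ih hd hx hy

theorem IsArc.card_ne [Fintype F] [DecidableEq F] {n r : ℕ} (hr : r ≤ n) (hnr : 1 ≤ n + r)
    (hodd : Odd (Fintype.card F)) (hfac : ((n + 1).factorial : F) ≠ 0)
    (hq : 2 * n + 4 * r + 1 ≤ Fintype.card F + 2) {S : Finset (Fin (n + r + 2) → F)}
    (hS : IsArc S) : S.card ≠ Fintype.card F + 2 := by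
  intro hcard
  obtain ⟨E, hES, hE⟩ := exists_subset_card_eq (show n + 1 ≤ S.card by omega)
  have hSE := card_sdiff_of_subset hES
  obtain ⟨X, hX', hX⟩ := exists_subset_card_eq (show n + r ≤ (S \ E).card by omega)
  have hSEX := card_sdiff_of_subset hX'
  obtain ⟨P, hP', hP⟩ := exists_subset_card_eq (show 2 * r ≤ ((S \ E) \ X).card by omega)
  obtain ⟨l, hlr, hl, rfl⟩ := exists_disjointPairs r P hP
  have hXS : X ⊆ S := hX'.trans sdiff_subset
  have hlS : pairSupport l ⊆ S := (hP'.trans sdiff_subset).trans sdiff_subset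
  have hEX : Disjoint E X := disjoint_of_subset_right hX' disjoint_sdiff
  have hXl : Disjoint X (pairSupport l) := disjoint_of_subset_right hP' disjoint_sdiff
  have hEl : Disjoint E (pairSupport l) :=
    disjoint_of_subset_right (hP'.trans sdiff_subset) disjoint_sdiff
  set ρ : Finset (Fin (n + r + 2) → F) → F := arcWeight S (E ∪ pairSupport l) with hρ
  have h0 : ∀ Y ⊆ X, Y.card = n →
      alternatingSum l (fun C => ρ C * (∏ x ∈ Y, spanForm C x)⁻¹) E = 0 := by
    intro Y hYX hY
    have hEY : Disjoint E Y := disjoint_of_subset_right hYX hEX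
    have hYl : Disjoint Y (pairSupport l) := disjoint_of_subset_left hYX hXl
    have hN : Disjoint (E ∪ Y) (pairSupport l) := disjoint_union_left.2 ⟨hEl, hYl⟩
    have hNc : (E ∪ Y).card = 2 * n + 1 := by rw [card_union_of_disjoint hEY]; omega
    have hWS : E ∪ Y ∪ pairSupport l ⊆ S :=
      union_subset (union_subset hES (hYX.trans hXS)) hlS
    have hWc : (E ∪ Y ∪ pairSupport l).card = 2 * (n + r) + 1 := by
      rw [card_union_of_disjoint hN]; omega
    have hzero : alternatingSum l (arcWeight S (E ∪ Y ∪ pairSupport l)) E = 0 := by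
      refine eq_zero_of_sum_insert_eq_zero n hfac (E ∪ Y) hNc _ (fun T hT hTc => ?_) E
        subset_union_left hE
      refine sum_alternatingSum_insert l hl n (E ∪ Y) hN _ (fun Z hZ hZc => ?_) T hT hTc
      exact hS.sum_arcWeight hnr hodd hcard _ hWS hWc Z hZ (by omega)
    rw [← hzero]
    refine alternatingSum_congr l hl _ _ E hEl fun D hED hDE _ => ?_
    have hDY : Disjoint Y D := by
      refine disjoint_of_subset_right hDE ?_
      exact disjoint_union_right.2 ⟨hEY.symm, hYl⟩
    have hsd : (E ∪ Y ∪ pairSupport l) \ D = (E ∪ pairSupport l) \ D ∪ Y := by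
      rw [union_right_comm, union_sdiff_distrib, sdiff_eq_self_of_disjoint hDY]
    have hdis : Disjoint ((E ∪ pairSupport l) \ D) Y :=
      disjoint_of_subset_left sdiff_subset (disjoint_union_left.2 ⟨hEY, hYl.symm⟩)
    simp only [hρ, arcWeight]
    rw [hsd, prod_union hdis, ← mul_assoc, mul_inv _ (∏ x ∈ Y, _)]
  have hfin := hS.alternatingSum_mul_prod hr l hl hlr E X hES hlS hXS hE hEl hEX hXl ρ h0
    (l.map Prod.snd) X subset_rfl (by rw [List.length_map, hlr, hX])
  rw [alternatingSum_eq_of_vanish] at hfin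
  · set C := (l.map Prod.fst).toFinset ∪ E with hC
    have hfst : (l.map Prod.fst).toFinset ⊆ pairSupport l := by
      intro z hz
      obtain ⟨y, hy, rfl⟩ := List.mem_map.1 (List.mem_toFinset.1 hz)
      exact fst_mem_pairSupport hy
    have hCsub : C ⊆ E ∪ pairSupport l := by
      rw [hC, union_comm]; exact union_subset_union subset_rfl hfst
    have hCc : C.card = n + r + 1 := by
      rw [hC, card_union_of_disjoint (disjoint_of_subset_left hfst hEl.symm), hl.card_fst]
      omega
    have hne : ∀ s ∈ S, s ∉ C → spanForm C s ≠ 0 := fun s hs hsC =>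
      hS.spanForm_ne_zero (hCsub.trans (union_subset hES hlS)) hCc hs hsC
    refine mul_ne_zero (mul_ne_zero ?_ ?_) ?_ hfin
    · refine inv_ne_zero (mul_ne_zero ?_ ?_) <;> refine prod_ne_zero_iff.2 fun s hs => ?_
      · exact hne s (mem_sdiff.1 hs).1 (mem_sdiff.1 hs).2
      · exact hne s (union_subset hES hlS (mem_sdiff.1 hs).1) (mem_sdiff.1 hs).2
    · refine List.prod_ne_zero fun h => ?_
      obtain ⟨v, hv, hv0⟩ := List.mem_map.1 h
      obtain ⟨y, hy, rfl⟩ := List.mem_map.1 hv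
      refine hne y.2 (hlS (snd_mem_pairSupport hy)) (fun hyC => ?_) hv0
      rcases mem_union.1 hyC with h | h
      · obtain ⟨z, hz, hzy⟩ := List.mem_map.1 (List.mem_toFinset.1 h)
        exact hl.fst_ne_snd hz hy hzy
      · exact disjoint_left.1 hEl h (snd_mem_pairSupport hy)
    · refine inv_ne_zero (prod_ne_zero_iff.2 fun x hx => hne x (hXS hx) fun hxC => ?_)
      exact (mem_union.1 (hCsub hxC)).elim (fun h => disjoint_left.1 hEX h hx)
        (disjoint_left.1 hXl hx)
  · intro x hx D hxD
    rw [List.prod_eq_zero, mul_zero, zero_mul]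
    exact List.mem_map.2 ⟨x.2, List.mem_map.2 ⟨x, hx, rfl⟩, spanForm_self D _ hxD⟩

theorem IsArc.mono {k : ℕ} {S T : Finset (Fin k → F)} (hS : IsArc S) (hTS : T ⊆ S) : IsArc T :=
  fun A hA => hS A (hA.trans hTS)

end Arc

end


/-- Let `p` be a prime, `h ≥ 2` (so `q = p^h` is not prime), and let `S` be a
finite set of vectors of `𝔽_q^k` (`k ≥ 1`) such that every subset of `S` of size `k` is a
basis of `𝔽_q^k`.  If `k ≤ 2p − 2` then `|S| ≤ q + 1`. -/
theorem statement1 (p h k : ℕ) (hp : p.Prime) (hh : 2 ≤ h) (hk : 1 ≤ k)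
    (F : Type) [Field F] [Fintype F] [DecidableEq F] (hF : Fintype.card F = p ^ h)
    (S : Finset (Fin k → F))
    (harc : ∀ A ⊆ S, A.card = k →
      LinearIndependent F (fun v : {x // x ∈ A} => (v : Fin k → F)) ∧
      Submodule.span F (A : Set (Fin k → F)) = ⊤)
    (hkp : k ≤ 2 * p - 2) :
    S.card ≤ p ^ h + 1 := by
  have hS : IsArc S := harc
  have hp2 := hp.two_le
  rw [← hF]
  obtain rfl | rfl | ⟨M, hM, rfl⟩ : k = 1 ∨ k = 2 ∨ ∃ M, 1 ≤ M ∧ k = M + 2 := by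
    rcases Nat.lt_or_ge k 3 with h | h
    · omega
    · exact Or.inr (Or.inr ⟨k - 2, by omega, by omega⟩)
  · have := Finset.card_le_univ S
    rw [Fintype.card_pi_const, pow_one] at this
    omega
  · exact hS.card_le_of_dim_two
  · by_contra! hlt
    obtain ⟨T, hTS, hT⟩ := Finset.exists_subset_card_eq
      (show Fintype.card F + 2 ≤ S.card by omega)
    have hpq : p ^ 2 ≤ Fintype.card F := by
      rw [hF]; exact Nat.pow_le_pow_right hp.pos hh
    have hodd : Odd (Fintype.card F) := by
      rw [hF]; exact (hp.odd_of_ne_two (by omega)).pow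
    have : Fact p.Prime := ⟨hp⟩
    have hchar : CharP F p := charP_of_card_eq_prime_pow hF
    obtain ⟨n, r, rfl, hr, hn⟩ : ∃ n r, M = n + r ∧ r ≤ n ∧ n + 1 < p ∧ r + 2 ≤ p :=
      ⟨M - M / 2, M / 2, by omega, by omega, by omega⟩
    refine (hS.mono hTS).card_ne hr hM hodd ?_ ?_ hT
    · rw [Ne, CharP.cast_eq_zero_iff F p, hp.dvd_factorial]
      omega
    · obtain ⟨c, rfl⟩ := Nat.exists_eq_add_of_le hn.2
      have hlin : 2 * (r + c) ≤ (r + c) ^ 2 + 1 := by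
        have := sq_nonneg (((r + c : ℕ) : ℤ) - 1)
        zify
        push_cast at this
        nlinarith
      have hsq : (r + 2 + c) ^ 2 = (r + c) ^ 2 + 4 * (r + c) + 4 := by ring
      have hnc := hn.1
      omega
end
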